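/- Let m ≥ 2, T ≥ 1, and let α_j ∈ C¹([T,∞); ℝ³) (1 ≤ j ≤ m) satisfy, for constants 0 < c₀ < C₀ and all t ≥ T: c₀ t ≤ |α_j(t) − α_k(t)| ≤ C₀ t for all j ≠ k, and |α̇_j(t)| ≤ C₀ for all j. Set a(t) = min_{j≠k} |α_j(t) − α_k(t)|. Then there exist constants c, C > 0 and functions φ_j : [T,∞) × ℝ³ → ℝ (1 ≤ j ≤ m), C¹ in t and C^∞ in x, such that: 0 ≤ φ_j ≤ 1; ∑_{j=1}^m φ_j(t,x) = 1 for all (t,x); |∂_t φ_j| + |∇_x φ_j| ≤ C/a(t) and |∂_t √φ_j| + |∇_x √φ_j| ≤ C/a(t) everywhere; φ_j(t,x) = 1 whenever |x − α_j(t)| ≤ c·a(t); and φ_j(t,x) = 0 whenever |x − α_k(t)| ≤ c·a(t) for some k ≠ j. -/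

import Mathlib

open Filter Real
open scoped Topology BigOperators

noncomputable section

abbrev E3 := EuclideanSpace ℝ (Fin 3)

/-- Minimal mutual separation of a configuration. -/
def minsep {m : ℕ} (α : Fin m → E3) : ℝ :=
  sInf ((fun p : Fin m × Fin m => ‖α p.1 - α p.2‖) '' {p | p.1 ≠ p.2})

lemma minsep_le {m : ℕ} (α : Fin m → E3) {j k : Fin m} (hjk : j ≠ k) :
    minsep α ≤ ‖α j - α k‖ := by
  refine csInf_le ⟨0, ?_⟩ ⟨(j, k), hjk, rfl⟩
  rintro _ ⟨p, _, rfl⟩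
  exact norm_nonneg _

lemma le_minsep {m : ℕ} {α : Fin m → E3} {i₁ i₂ : Fin m} (hi : i₁ ≠ i₂) {b : ℝ}
    (hb : ∀ j k, j ≠ k → b ≤ ‖α j - α k‖) : b ≤ minsep α := by
  refine le_csInf ⟨_, (i₁, i₂), hi, rfl⟩ ?_
  rintro _ ⟨p, hp, rfl⟩
  exact hb p.1 p.2 hp

/-- A smooth cutoff whose derivative decays at least like `(1 + ‖w‖)⁻¹`. -/
lemma exists_cutoff_profile {r R : ℝ} (hr : 0 < r) (hrR : r < R) :
    ∃ H : E3 → ℝ, ContDiff ℝ (⊤ : ℕ∞) H ∧ (∀ w, 0 ≤ H w ∧ H w ≤ 1) ∧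
      (∀ w, ‖w‖ ≤ r → H w = 1) ∧ (∀ w, R ≤ ‖w‖ → H w = 0) ∧
      ∃ M > (0:ℝ), ∀ w, ‖fderiv ℝ H w‖ * (1 + ‖w‖) ≤ M := by
  let f : ContDiffBump (0 : E3) := ⟨r, R, hr, hrR⟩
  have hf : ContDiff ℝ (⊤ : ℕ∞) (f : E3 → ℝ) := f.contDiff
  refine ⟨f, hf, fun w => ⟨f.nonneg, f.le_one⟩, fun w hw => ?_, fun w hw => ?_, ?_⟩
  · exact f.one_of_mem_closedBall (by simpa [f] using hw)
  · exact f.zero_of_le_dist (by simpa [f] using hw)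
  · have hcont : Continuous fun w => (1 + ‖w‖) • fderiv ℝ (f : E3 → ℝ) w :=
      (continuous_const.add continuous_norm).smul (hf.continuous_fderiv (by simp))
    have hsupp : HasCompactSupport fun w => (1 + ‖w‖) • fderiv ℝ (f : E3 → ℝ) w :=
      (f.hasCompactSupport.fderiv ℝ).smul_left (f := fun w : E3 => 1 + ‖w‖)
    obtain ⟨M, hM⟩ := hsupp.exists_bound_of_continuous hcont
    refine ⟨max M 1, by positivity, fun w => le_trans ?_ (le_max_left M 1)⟩
    have h := hM w
    rw [norm_smul, Real.norm_of_nonneg (by positivity)] at h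
    linarith

/-- The cutoff `H` transported along the trajectory `a`, at scale `t`. -/
def movingCutoff (H : E3 → ℝ) (a : ℝ → E3) (t : ℝ) (x : E3) : ℝ :=
  H (t⁻¹ • (x - a t))

lemma contDiff_movingCutoff {H : E3 → ℝ} (hH : ContDiff ℝ (⊤ : ℕ∞) H) (a : ℝ → E3) (t : ℝ) :
    ContDiff ℝ (⊤ : ℕ∞) (movingCutoff H a t) :=
  hH.comp ((contDiff_id.sub contDiff_const).const_smul t⁻¹)

lemma contDiffOn_movingCutoff {H : E3 → ℝ} (hH : ContDiff ℝ (⊤ : ℕ∞) H) {a : ℝ → E3} {T : ℝ}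
    (hT : 0 < T) (ha : ContDiffOn ℝ 1 a (Set.Ici T)) (x : E3) :
    ContDiffOn ℝ 1 (fun t => movingCutoff H a t x) (Set.Ici T) := by
  have hH1 : ContDiff ℝ 1 H := hH.of_le (by exact_mod_cast le_top)
  have hinv : ContDiffOn ℝ 1 (fun t : ℝ => t⁻¹) (Set.Ici T) :=
    contDiffOn_id.inv fun t ht => (hT.trans_le ht).ne'
  have hinner : ContDiffOn ℝ 1 (fun t => t⁻¹ • (x - a t)) (Set.Ici T) :=
    hinv.smul (contDiffOn_const.sub ha)
  exact hH1.comp_contDiffOn hinner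

lemma norm_fderiv_movingCutoff_le {H : E3 → ℝ} (hH : ContDiff ℝ (⊤ : ℕ∞) H) {M : ℝ}
    (hM : ∀ w, ‖fderiv ℝ H w‖ * (1 + ‖w‖) ≤ M) (a : ℝ → E3) {t : ℝ} (ht : 0 < t) (x : E3) :
    ‖fderiv ℝ (movingCutoff H a t) x‖ ≤ M / t := by
  have hinner : HasFDerivAt (fun y : E3 => t⁻¹ • (y - a t))
      (t⁻¹ • ContinuousLinearMap.id ℝ E3) x :=
    ((hasFDerivAt_id x).sub_const (a t)).const_smul t⁻¹
  have houter := (hH.differentiable (by simp) (t⁻¹ • (x - a t))).hasFDerivAt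
  have h : HasFDerivAt (movingCutoff H a t) _ x := houter.comp x hinner
  rw [h.fderiv, ContinuousLinearMap.comp_smul, ContinuousLinearMap.comp_id, norm_smul,
    Real.norm_of_nonneg (by positivity), inv_mul_eq_div]
  gcongr
  have := hM (t⁻¹ • (x - a t))
  nlinarith [norm_nonneg (fderiv ℝ H (t⁻¹ • (x - a t))), norm_nonneg (t⁻¹ • (x - a t))]

lemma abs_derivWithin_movingCutoff_le {H : E3 → ℝ} (hH : ContDiff ℝ (⊤ : ℕ∞) H) {M : ℝ}
    (hM : ∀ w, ‖fderiv ℝ H w‖ * (1 + ‖w‖) ≤ M) {a : ℝ → E3} {T V : ℝ} (hT : 0 < T)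
    (hV : 0 ≤ V) (ha : ContDiffOn ℝ 1 a (Set.Ici T)) {t : ℝ} (ht : t ∈ Set.Ici T)
    (hvel : ‖derivWithin a (Set.Ici T) t‖ ≤ V) (x : E3) :
    |derivWithin (fun s => movingCutoff H a s x) (Set.Ici T) t| ≤ M * (1 + V) / t := by
  have ht0 : 0 < t := hT.trans_le ht
  have hda := (ha.differentiableOn (by simp) t ht).hasDerivWithinAt
  have hinner := (hasDerivAt_inv ht0.ne').hasDerivWithinAt.smul (hda.const_sub x)
  have houter := (hH.differentiable (by simp) (t⁻¹ • (x - a t))).hasFDerivAt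
  have h : HasDerivWithinAt (fun s => movingCutoff H a s x) _ (Set.Ici T) t :=
    houter.comp_hasDerivWithinAt t hinner
  rw [h.derivWithin (uniqueDiffOn_Ici T t ht), ← Real.norm_eq_abs]
  set w := t⁻¹ • (x - a t) with hw
  set L := fderiv ℝ H w
  have hvec : t⁻¹ • -derivWithin a (Set.Ici T) t + (-(t ^ 2)⁻¹) • (x - a t) =
      t⁻¹ • (-derivWithin a (Set.Ici T) t - w) := by
    rw [hw, smul_sub t⁻¹, smul_smul, neg_smul, ← sub_eq_add_neg, ← mul_inv, ← sq]
  rw [hvec]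
  have hnorm : ‖-derivWithin a (Set.Ici T) t - w‖ ≤ V + ‖w‖ :=
    (norm_sub_le _ _).trans (by rw [norm_neg]; gcongr)
  calc ‖L (t⁻¹ • (-derivWithin a (Set.Ici T) t - w))‖
      ≤ ‖L‖ * (t⁻¹ * (V + ‖w‖)) := by
        refine (L.le_opNorm _).trans ?_
        rw [norm_smul, Real.norm_of_nonneg (by positivity)]
        gcongr
    _ = ‖L‖ * (V + ‖w‖) / t := by ring
    _ ≤ M * (1 + V) / t := by
        refine div_le_div_of_nonneg_right ?_ ht0.le
        calc ‖L‖ * (V + ‖w‖) ≤ ‖L‖ * ((1 + ‖w‖) * (1 + V)) := by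
              gcongr
              nlinarith [mul_nonneg hV (norm_nonneg w)]
          _ = ‖L‖ * (1 + ‖w‖) * (1 + V) := by ring
          _ ≤ M * (1 + V) := mul_le_mul_of_nonneg_right (hM w) (by linarith)

lemma norm_fderivWithin_sin_half_pi_mul_le {E : Type*} [NormedAddCommGroup E] [NormedSpace ℝ E]
    {v : E → ℝ} {s : Set E} {x : E} (hs : UniqueDiffWithinAt ℝ s x)
    (hv : DifferentiableWithinAt ℝ v s x) :
    ‖fderivWithin ℝ (fun y => sin (π / 2 * v y)) s x‖ ≤ 2 * ‖fderivWithin ℝ v s x‖ := by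
  have h := (hv.hasFDerivWithinAt.const_mul (π / 2)).sin
  rw [h.fderivWithin hs, smul_smul, norm_smul]
  gcongr
  rw [norm_mul, Real.norm_eq_abs, Real.norm_eq_abs, abs_of_pos (by positivity : 0 < π / 2)]
  nlinarith [abs_cos_le_one (π / 2 * v x), abs_nonneg (cos (π / 2 * v x)), pi_le_four, pi_pos]

lemma norm_fderivWithin_sin_sq_half_pi_mul_le {E : Type*} [NormedAddCommGroup E]
    [NormedSpace ℝ E] {v : E → ℝ} {s : Set E} {x : E} (hs : UniqueDiffWithinAt ℝ s x)
    (hv : DifferentiableWithinAt ℝ v s x) :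
    ‖fderivWithin ℝ (fun y => sin (π / 2 * v y) ^ 2) s x‖ ≤ 4 * ‖fderivWithin ℝ v s x‖ := by
  have h := (hv.const_mul (π / 2)).sin.hasFDerivWithinAt.pow 2
  rw [h.fderivWithin hs, norm_smul]
  have hsin := norm_fderivWithin_sin_half_pi_mul_le hs hv
  have htwo : ‖(2 • sin (π / 2 * v x) ^ (2 - 1) : ℝ)‖ ≤ 2 := by
    simpa using abs_sin_le_one (π / 2 * v x)
  calc _ ≤ 2 * (2 * ‖fderivWithin ℝ v s x‖) := by gcongr
    _ = _ := by ring

/-- The phases of the partition: the distinguished index `z` takes what the others leave. -/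
def phase {m : ℕ} (z : Fin m) (u : Fin m → ℝ) (j : Fin m) : ℝ :=
  if j = z then 1 - ∑ k ∈ Finset.univ.erase z, u k else u j

lemma phase_eq_sub_of_forall_ne {m : ℕ} {z : Fin m} {u : Fin m → ℝ} {k : Fin m} (hk : k ≠ z)
    (hu : ∀ i, i ≠ k → i ≠ z → u i = 0) :
    phase z u z = 1 - u k := by
  rw [phase, if_pos rfl, Finset.sum_eq_single_of_mem k (by simp [hk])]
  intro i hi hik
  exact hu i hik (Finset.ne_of_mem_erase hi)

lemma exists_phase_support {m : ℕ} {z y : Fin m} (hyz : y ≠ z) {u : Fin m → ℝ}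
    (hu : ∀ i k, i ≠ z → k ≠ z → i ≠ k → u i ≠ 0 → u k = 0) :
    ∃ k, k ≠ z ∧ (∀ i, i ≠ k → i ≠ z → u i = 0) := by
  by_cases h : ∃ k, k ≠ z ∧ u k ≠ 0
  · obtain ⟨k, hkz, hk⟩ := h
    exact ⟨k, hkz, fun i hik hiz => hu k i hkz hiz hik.symm hk⟩
  · push Not at h
    exact ⟨y, hyz, fun i _ hiz => h i hiz⟩

lemma phase_mem_Icc {m : ℕ} {z y : Fin m} (hyz : y ≠ z) {u : Fin m → ℝ}
    (hu : ∀ i k, i ≠ z → k ≠ z → i ≠ k → u i ≠ 0 → u k = 0)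
    (hu01 : ∀ k, 0 ≤ u k ∧ u k ≤ 1) (j : Fin m) : 0 ≤ phase z u j ∧ phase z u j ≤ 1 := by
  by_cases hj : j = z
  · obtain ⟨k, hkz, hk⟩ := exists_phase_support hyz hu
    rw [hj, phase_eq_sub_of_forall_ne hkz hk]
    constructor <;> linarith [(hu01 k).1, (hu01 k).2]
  · rw [phase, if_neg hj]
    exact hu01 j

lemma sum_sin_sq_phase {m : ℕ} {z y : Fin m} (hyz : y ≠ z) {u : Fin m → ℝ}
    (hu : ∀ i k, i ≠ z → k ≠ z → i ≠ k → u i ≠ 0 → u k = 0) :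
    ∑ j, sin (π / 2 * phase z u j) ^ 2 = 1 := by
  obtain ⟨k, hkz, hk⟩ := exists_phase_support hyz hu
  rw [← Finset.add_sum_erase _ _ (Finset.mem_univ z),
    Finset.sum_eq_single_of_mem k (by simp [hkz])]
  · rw [phase_eq_sub_of_forall_ne hkz hk, phase, if_neg hkz, mul_sub, mul_one, sin_pi_div_two_sub]
    exact cos_sq_add_sin_sq _
  · intro i hi hik
    have hiz := Finset.ne_of_mem_erase hi
    simp [phase, if_neg hiz, hk i hik hiz]

lemma contDiffOn_phase {E : Type*} [NormedAddCommGroup E] [NormedSpace ℝ E] {m : ℕ} (z : Fin m)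
    {u : Fin m → E → ℝ} {s : Set E} {n : WithTop ℕ∞} (hu : ∀ k, ContDiffOn ℝ n (u k) s)
    (j : Fin m) : ContDiffOn ℝ n (fun y => phase z (fun k => u k y) j) s := by
  unfold phase
  split_ifs
  · exact contDiffOn_const.sub (ContDiffOn.sum fun k _ => hu k)
  · exact hu j

lemma norm_fderivWithin_phase_le {E : Type*} [NormedAddCommGroup E] [NormedSpace ℝ E] {m : ℕ}
    (z : Fin m) {u : Fin m → E → ℝ} {s : Set E} {x : E} (hs : UniqueDiffWithinAt ℝ s x)
    (hu : ∀ k, DifferentiableWithinAt ℝ (u k) s x) {B : ℝ}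
    (hB : ∀ k, ‖fderivWithin ℝ (u k) s x‖ ≤ B) (j : Fin m) :
    ‖fderivWithin ℝ (fun y => phase z (fun k => u k y) j) s x‖ ≤ m * B := by
  have hB0 : 0 ≤ B := (norm_nonneg _).trans (hB j)
  unfold phase
  split_ifs
  · rw [fderivWithin_const_sub hs, norm_neg, fderivWithin_fun_sum hs fun k _ => hu k]
    calc _ ≤ ∑ _k ∈ Finset.univ.erase z, B := norm_sum_le_of_le _ fun k _ => hB k
      _ ≤ ∑ _k : Fin m, B := Finset.sum_le_sum_of_subset_of_nonneg (Finset.erase_subset _ _)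
          fun _ _ _ => hB0
      _ = m * B := by simp
  · refine (hB j).trans (le_mul_of_one_le_left hB0 ?_)
    exact_mod_cast j.pos

/-- existence of a partition of unity adapted to trajectories that
separate linearly in time. -/
theorem cutoff_partition_of_unity
    (m : ℕ) (hm : 2 ≤ m) (T : ℝ) (hT : 1 ≤ T)
    (α : Fin m → ℝ → E3) (c₀ C₀ : ℝ) (hc₀ : 0 < c₀) (hc₀C₀ : c₀ < C₀)
    (hα : ∀ j, ContDiffOn ℝ 1 (α j) (Set.Ici T))
    (hsep : ∀ t ∈ Set.Ici T, ∀ j k, j ≠ k →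
      c₀ * t ≤ ‖α j t - α k t‖ ∧ ‖α j t - α k t‖ ≤ C₀ * t)
    (hvel : ∀ j, ∀ t ∈ Set.Ici T, ‖derivWithin (α j) (Set.Ici T) t‖ ≤ C₀) :
    ∃ c > (0:ℝ), ∃ C > (0:ℝ), ∃ φ : Fin m → ℝ → E3 → ℝ,
      (∀ j x, ContDiffOn ℝ 1 (fun t => φ j t x) (Set.Ici T)) ∧
      (∀ j, ∀ t ∈ Set.Ici T, ContDiff ℝ (⊤ : ℕ∞) (φ j t)) ∧
      (∀ j, ∀ t ∈ Set.Ici T, ∀ x, 0 ≤ φ j t x ∧ φ j t x ≤ 1) ∧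
      (∀ t ∈ Set.Ici T, ∀ x, ∑ j, φ j t x = 1) ∧
      (∀ j, ∀ t ∈ Set.Ici T, ∀ x,
        |derivWithin (fun s => φ j s x) (Set.Ici T) t| + ‖fderiv ℝ (φ j t) x‖ ≤
          C / minsep (fun i => α i t)) ∧
      (∀ j, ∀ t ∈ Set.Ici T, ∀ x,
        |derivWithin (fun s => Real.sqrt (φ j s x)) (Set.Ici T) t| +
          ‖fderiv ℝ (fun y => Real.sqrt (φ j t y)) x‖ ≤ C / minsep (fun i => α i t)) ∧
      (∀ j, ∀ t ∈ Set.Ici T, ∀ x,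
        ‖x - α j t‖ ≤ c * minsep (fun i => α i t) → φ j t x = 1) ∧
      (∀ j k, j ≠ k → ∀ t ∈ Set.Ici T, ∀ x,
        ‖x - α k t‖ ≤ c * minsep (fun i => α i t) → φ j t x = 0) := by
  have hT0 : 0 < T := by linarith
  have hC₀ : 0 < C₀ := hc₀.trans hc₀C₀
  obtain ⟨H, hH, hH01, hH1, hH0, M, hM0, hM⟩ :=
    exists_cutoff_profile (r := c₀ / 4) (R := c₀ / 3) (by positivity) (by linarith)
  let z : Fin m := ⟨0, by omega⟩
  let y : Fin m := ⟨1, by omega⟩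
  have hyz : y ≠ z := by simp [y, z]
  have hpos : ∀ t ∈ Set.Ici T, 0 < t := fun t ht => hT0.trans_le ht
  have hmin_le : ∀ t ∈ Set.Ici T, minsep (fun i => α i t) ≤ C₀ * t := fun t ht =>
    (minsep_le _ hyz).trans (hsep t ht y z hyz).2
  have hmin_pos : ∀ t ∈ Set.Ici T, 0 < minsep (fun i => α i t) := fun t ht =>
    (mul_pos hc₀ (hpos t ht)).trans_le (le_minsep hyz fun j k hjk => (hsep t ht j k hjk).1)
  let u : ℝ → E3 → Fin m → ℝ := fun t x k => movingCutoff H (α k) t x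
  let v : Fin m → ℝ → E3 → ℝ := fun j t x => phase z (u t x) j
  have hu01 : ∀ t x k, 0 ≤ u t x k ∧ u t x k ≤ 1 := fun t x k => hH01 _
  have hu_near : ∀ t ∈ Set.Ici T, ∀ x k,
      ‖x - α k t‖ ≤ c₀ / (4 * C₀) * minsep (fun i => α i t) → u t x k = 1 := by
    intro t ht x k hx
    refine hH1 _ ?_
    rw [norm_smul, norm_inv, Real.norm_of_nonneg (hpos t ht).le, inv_mul_le_iff₀ (hpos t ht)]
    calc _ ≤ c₀ / (4 * C₀) * (C₀ * t) := hx.trans (by gcongr; exact hmin_le t ht)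
      _ = t * (c₀ / 4) := by field_simp
  have hu_far : ∀ t ∈ Set.Ici T, ∀ x k, t * (c₀ / 3) ≤ ‖x - α k t‖ → u t x k = 0 := by
    intro t ht x k hx
    refine hH0 _ ?_
    rwa [norm_smul, norm_inv, Real.norm_of_nonneg (hpos t ht).le, le_inv_mul_iff₀ (hpos t ht)]
  have hu_disj : ∀ t ∈ Set.Ici T, ∀ x i k, i ≠ k → u t x i ≠ 0 → u t x k = 0 := by
    intro t ht x i k hik hi
    refine hu_far t ht x k ?_
    have hxi : ‖x - α i t‖ < t * (c₀ / 3) := not_le.1 fun h => hi (hu_far t ht x i h)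
    have htri := norm_sub_le_norm_sub_add_norm_sub (α i t) x (α k t)
    rw [norm_sub_rev (α i t) x] at htri
    nlinarith [(hsep t ht i k hik).1, mul_pos hc₀ (hpos t ht)]
  have hu_other : ∀ t ∈ Set.Ici T, ∀ x i k, i ≠ k →
      ‖x - α i t‖ ≤ c₀ / (4 * C₀) * minsep (fun i => α i t) → u t x k = 0 :=
    fun t ht x i k hik hx => hu_disj t ht x i k hik (by simp [hu_near t ht x i hx])
  have hv01 : ∀ j, ∀ t ∈ Set.Ici T, ∀ x, 0 ≤ v j t x ∧ v j t x ≤ 1 := fun j t ht x =>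
    phase_mem_Icc hyz (fun i k _ _ hik => hu_disj t ht x i k hik) (hu01 t x) j
  have hsqrt : ∀ j, ∀ t ∈ Set.Ici T, ∀ x,
      √(sin (π / 2 * v j t x) ^ 2) = sin (π / 2 * v j t x) := by
    intro j t ht x
    obtain ⟨h0, h1⟩ := hv01 j t ht x
    exact Real.sqrt_sq (sin_nonneg_of_nonneg_of_le_pi (by positivity) (by nlinarith [pi_pos]))
  have hvt : ∀ j x, ContDiffOn ℝ 1 (fun t => v j t x) (Set.Ici T) := fun j x =>
    contDiffOn_phase z (fun k => contDiffOn_movingCutoff hH hT0 (hα k) x) j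
  have hvx : ∀ j t, ContDiff ℝ (⊤ : ℕ∞) (v j t) := fun j t =>
    contDiffOn_univ.1
      (contDiffOn_phase z (fun k => (contDiff_movingCutoff hH (α k) t).contDiffOn) j)
  have hvt_le : ∀ j, ∀ t ∈ Set.Ici T, ∀ x,
      ‖fderivWithin ℝ (fun s => v j s x) (Set.Ici T) t‖ ≤ m * (M * (1 + C₀) / t) := by
    intro j t ht x
    refine norm_fderivWithin_phase_le z (uniqueDiffOn_Ici T t ht)
      (fun k => (contDiffOn_movingCutoff hH hT0 (hα k) x).differentiableOn (by simp) t ht)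
      (fun k => ?_) j
    rw [← norm_derivWithin_eq_norm_fderivWithin]
    exact abs_derivWithin_movingCutoff_le hH hM hT0 hC₀.le (hα k) ht (hvel k t ht) x
  have hvx_le : ∀ j, ∀ t ∈ Set.Ici T, ∀ x,
      ‖fderivWithin ℝ (v j t) Set.univ x‖ ≤ m * (M / t) := by
    intro j t ht x
    refine norm_fderivWithin_phase_le z uniqueDiffWithinAt_univ
      (fun k => ((contDiff_movingCutoff hH (α k) t).differentiable (by simp)
        x).differentiableWithinAt) (fun k => ?_) j
    rw [fderivWithin_univ]
    exact norm_fderiv_movingCutoff_le hH hM (α k) (hpos t ht) x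
  have hvt_diff : ∀ j x, ∀ t ∈ Set.Ici T,
      DifferentiableWithinAt ℝ (fun s => v j s x) (Set.Ici T) t := fun j x t ht =>
    (hvt j x).differentiableOn (by simp) t ht
  have hvx_diff : ∀ j t x, DifferentiableWithinAt ℝ (v j t) Set.univ x := fun j t x =>
    ((hvx j t).differentiable (by simp) x).differentiableWithinAt
  have hm0 : (0 : ℝ) < m := by exact_mod_cast (by omega : 0 < m)
  let K : ℝ := m * M * (2 + C₀)
  have hK : 0 < K := by positivity
  have hbound : ∀ t ∈ Set.Ici T, ∀ b : ℝ, b ≤ 4 * (K / t) →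
      b ≤ 4 * K * C₀ / minsep (fun i => α i t) := by
    intro t ht b hb
    have ht0 := hpos t ht
    refine hb.trans ?_
    rw [le_div_iff₀ (hmin_pos t ht)]
    calc _ ≤ 4 * (K / t) * (C₀ * t) := by gcongr; exact hmin_le t ht
      _ = 4 * K * C₀ := by field_simp
  have hKt : ∀ t ∈ Set.Ici T, m * (M * (1 + C₀) / t) + m * (M / t) = K / t := by
    intro t ht
    simp only [K]
    ring
  refine ⟨c₀ / (4 * C₀), by positivity, 4 * K * C₀, by positivity,
    fun j t x => sin (π / 2 * v j t x) ^ 2, ?_, ?_, ?_, ?_, ?_, ?_, ?_, ?_⟩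
  · exact fun j x => ((contDiffOn_const.mul (hvt j x)).sin).pow 2
  · exact fun j t _ => ((contDiff_const.mul (hvx j t)).sin).pow 2
  · exact fun j t _ x => ⟨sq_nonneg _, sin_sq_le_one _⟩
  · exact fun t ht x => sum_sin_sq_phase hyz fun i k _ _ hik => hu_disj t ht x i k hik
  · intro j t ht x
    refine hbound t ht _ ?_
    have h1 := norm_fderivWithin_sin_sq_half_pi_mul_le (uniqueDiffOn_Ici T t ht)
      (hvt_diff j x t ht)
    have h2 := norm_fderivWithin_sin_sq_half_pi_mul_le uniqueDiffWithinAt_univ (hvx_diff j t x)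
    rw [fderivWithin_univ] at h2
    rw [← Real.norm_eq_abs, norm_derivWithin_eq_norm_fderivWithin]
    linarith [hvt_le j t ht x, hvx_le j t ht x, hKt t ht]
  · intro j t ht x
    refine hbound t ht _ ?_
    have h1 := norm_fderivWithin_sin_half_pi_mul_le (uniqueDiffOn_Ici T t ht)
      (hvt_diff j x t ht)
    have h2 := norm_fderivWithin_sin_half_pi_mul_le uniqueDiffWithinAt_univ (hvx_diff j t x)
    rw [fderivWithin_univ] at h2
    rw [derivWithin_congr (fun s hs => hsqrt j s hs x) (hsqrt j t ht x), funext (hsqrt j t ht),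
      ← Real.norm_eq_abs, norm_derivWithin_eq_norm_fderivWithin]
    have hKpos := div_pos hK (hpos t ht)
    linarith [hvt_le j t ht x, hvx_le j t ht x, hKt t ht]
  · intro j t ht x hx
    suffices h : v j t x = 1 by simp [h]
    by_cases hj : j = z
    · subst hj
      have hzero := hu_other t ht x z y hyz.symm hx
      have hphase : phase z (u t x) z = 1 - u t x y :=
        phase_eq_sub_of_forall_ne hyz fun i _ hiz => hu_other t ht x z i hiz.symm hx
      simp only [v, hphase, hzero, sub_zero]
    · simp only [v, phase, if_neg hj, hu_near t ht x j hx]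
  · intro j k hjk t ht x hx
    suffices h : v j t x = 0 by simp [h]
    by_cases hj : j = z
    · subst hj
      have hphase : phase z (u t x) z = 1 - u t x k :=
        phase_eq_sub_of_forall_ne hjk.symm fun i hik _ => hu_other t ht x k i hik.symm hx
      simp only [v, hphase, hu_near t ht x k hx, sub_self]
    · simp only [v, phase, if_neg hj, hu_other t ht x k j hjk.symm hx]

end
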